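/- arXiv:1612.01519 — 10 statements merged into one kernel-verified Lean document; each statement's English description precedes it below -/
import Mathlib

section
/- Let 1 < p < ∞ and assume ∑_{n=0}^∞ λ_n^{-p} < ∞ (so that the unit vectors e_m belong to Λ_p). Then the James constant of Λ_p equals 2; that is, sup{ min(‖x+y‖_p, ‖x−y‖_p) : x, y real sequences with ‖x‖_p = ‖y‖_p = 1 } = 2. -/
open Filter Topology

/-- Weight `λ_k − λ_{k−1}` with the convention `λ_{−1} = 0`. -/
noncomputable def dLam (l : ℕ → ℝ) (k : ℕ) : ℝ :=
  l k - (if k = 0 then 0 else l (k - 1))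

/-- `Λx(n) = (1/λ_n) ∑_{k=0}^n (λ_k − λ_{k−1})|x_k|`. -/
noncomputable def LamAvg (l : ℕ → ℝ) (x : ℕ → ℝ) (n : ℕ) : ℝ :=
  (1 / l n) * ∑ k ∈ Finset.range (n + 1), dLam l k * |x k|

/-- The norm of the space `Λ_p`, `‖x‖_p = (∑_{n=0}^∞ (Λx(n))^p)^{1/p}`. -/
noncomputable def LamNorm (l : ℕ → ℝ) (p : ℝ) (x : ℕ → ℝ) : ℝ :=
  (∑' n : ℕ, (LamAvg l x n) ^ p) ^ (1 / p)

lemma dLam_pos {l : ℕ → ℝ} (hpos : ∀ k, 0 < l k) (hmono : StrictMono l) (k : ℕ) :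
    0 < dLam l k := by
  unfold dLam
  split_ifs with h
  · simpa using hpos k
  · exact sub_pos.2 (hmono (by omega))

lemma LamAvg_nonneg {l : ℕ → ℝ} (hpos : ∀ k, 0 < l k) (hmono : StrictMono l)
    (x : ℕ → ℝ) (n : ℕ) : 0 ≤ LamAvg l x n :=
  mul_nonneg (one_div_nonneg.2 (hpos n).le)
    (Finset.sum_nonneg fun k _ => mul_nonneg (dLam_pos hpos hmono k).le (abs_nonneg _))

lemma LamAvg_le_add {l : ℕ → ℝ} (hpos : ∀ k, 0 < l k) (hmono : StrictMono l)
    {x y z : ℕ → ℝ} (h : ∀ k, |z k| ≤ |x k| + |y k|) (n : ℕ) :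
    LamAvg l z n ≤ LamAvg l x n + LamAvg l y n := by
  unfold LamAvg
  rw [← mul_add, ← Finset.sum_add_distrib]
  refine mul_le_mul_of_nonneg_left (Finset.sum_le_sum fun k _ => ?_)
    (one_div_nonneg.2 (hpos n).le)
  rw [← mul_add]
  exact mul_le_mul_of_nonneg_left (h k) (dLam_pos hpos hmono k).le

lemma LamAvg_eq_add {l : ℕ → ℝ} {x y z : ℕ → ℝ} (h : ∀ k, |z k| = |x k| + |y k|) (n : ℕ) :
    LamAvg l z n = LamAvg l x n + LamAvg l y n := by
  simp only [LamAvg, h, mul_add, Finset.sum_add_distrib]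

/-- A sequence of norm one lies in the space, as a divergent sum would give norm zero. -/
lemma summable_of_LamNorm_eq_one {l : ℕ → ℝ} {p : ℝ} (hp : 1 < p) {x : ℕ → ℝ}
    (hx : LamNorm l p x = 1) : Summable fun n => LamAvg l x n ^ p := by
  by_contra h
  rw [LamNorm, tsum_eq_zero_of_not_summable h, Real.zero_rpow (by positivity)] at hx
  exact zero_ne_one hx

lemma summable_and_LamNorm_le_add {l : ℕ → ℝ} {p : ℝ} (hpos : ∀ k, 0 < l k)
    (hmono : StrictMono l) (hp : 1 < p) {x y z : ℕ → ℝ} (h : ∀ k, |z k| ≤ |x k| + |y k|)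
    (hx : Summable fun n => LamAvg l x n ^ p) (hy : Summable fun n => LamAvg l y n ^ p) :
    (Summable fun n => LamAvg l z n ^ p) ∧
      LamNorm l p z ≤ LamNorm l p x + LamNorm l p y := by
  obtain ⟨hs, hle⟩ := Real.Lp_add_le_tsum_of_nonneg hp.le (LamAvg_nonneg hpos hmono x)
    (LamAvg_nonneg hpos hmono y) hx hy
  have hterm : ∀ n, LamAvg l z n ^ p ≤ (LamAvg l x n + LamAvg l y n) ^ p := fun n =>
    Real.rpow_le_rpow (LamAvg_nonneg hpos hmono z n) (LamAvg_le_add hpos hmono h n)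
      (by positivity)
  have hnn : ∀ n, 0 ≤ LamAvg l z n ^ p := fun n =>
    Real.rpow_nonneg (LamAvg_nonneg hpos hmono z n) p
  have hz := Summable.of_nonneg_of_le hnn hterm hs
  exact ⟨hz, (Real.rpow_le_rpow (tsum_nonneg hnn) (hz.tsum_le_tsum hterm hs)
    (by positivity)).trans hle⟩

lemma LamAvg_single {l : ℕ → ℝ} (m n : ℕ) (c : ℝ) :
    LamAvg l (Pi.single m c) n = if m ≤ n then dLam l m * |c| / l n else 0 := by
  have h : ∀ k, dLam l k * |(Pi.single m c : ℕ → ℝ) k| = if k = m then dLam l m * |c| else 0 := by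
    intro k
    by_cases hk : k = m
    · subst hk; simp
    · simp [hk]
  simp only [LamAvg, h, Finset.sum_ite_eq', Finset.mem_range, Nat.lt_succ_iff]
  split_ifs <;> ring

/-- If consecutive terms of a positive summable sequence have ratio tending to one, then so do
its consecutive tails. -/
lemma tendsto_tail_ratio {a : ℕ → ℝ} (ha : ∀ n, 0 < a n) (hs : Summable a)
    (hr : Tendsto (fun n => a (n + 1) / a n) atTop (𝓝 1)) :
    Tendsto (fun m => (∑' n, a (n + (m + 1))) / ∑' n, a (n + m)) atTop (𝓝 1) := by
  have hsm : ∀ m, Summable fun n => a (n + m) := fun m => (summable_nat_add_iff m).2 hs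
  have hS : ∀ m, 0 < ∑' n, a (n + m) := fun m =>
    (hsm m).tsum_pos (fun n => (ha _).le) 0 (ha _)
  have hshift : ∀ j : ℕ, Tendsto (fun m => a (j + m) / a m) atTop (𝓝 1) := by
    intro j
    induction j with
    | zero => simp [div_self (ha _).ne']
    | succ j ih =>
      have := (hr.comp (tendsto_add_atTop_nat j)).mul ih
      rw [one_mul] at this
      refine this.congr fun m => ?_
      simp only [Function.comp]
      rw [add_comm m j, div_mul_div_cancel₀ (ha _).ne', add_right_comm]
  have hinf : Tendsto (fun m => (∑' n, a (n + m)) / a m) atTop atTop := by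
    refine tendsto_atTop.2 fun b => ?_
    obtain ⟨N, hN⟩ := exists_nat_gt b
    have hsum : Tendsto (fun m => ∑ j ∈ Finset.range N, a (j + m) / a m) atTop (𝓝 (N : ℝ)) := by
      simpa using tendsto_finsetSum (Finset.range N) fun j _ => hshift j
    filter_upwards [hsum.eventually_const_lt hN] with m hm
    rw [← Finset.sum_div] at hm
    exact hm.le.trans (div_le_div_of_nonneg_right
      ((hsm m).sum_le_tsum _ fun n _ => (ha _).le) (ha m).le)
  have h := (tendsto_const_nhds (x := (1 : ℝ))).sub hinf.inv_tendsto_atTop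
  rw [sub_zero] at h
  refine h.congr fun m => ?_
  have hsplit : ∑' n, a (n + m) = a m + ∑' n, a (n + (m + 1)) := by
    rw [(hsm m).tsum_eq_zero_add]
    simp [add_assoc, add_comm 1 m]
  simp only [Pi.inv_apply, inv_div]
  rw [eq_div_iff (hS m).ne', sub_mul, div_mul_cancel₀ _ (hS m).ne']
  linarith

lemma exists_unit_min_ge {l : ℕ → ℝ} {p : ℝ} (hpos : ∀ k, 0 < l k) (hmono : StrictMono l)
    (hp : 1 < p) (hsum : Summable fun n => l n ^ (-p)) (m : ℕ) :
    ∃ x y : ℕ → ℝ, LamNorm l p x = 1 ∧ LamNorm l p y = 1 ∧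
      2 * ((∑' n, l (n + (m + 1)) ^ (-p)) / ∑' n, l (n + m) ^ (-p)) ^ (1 / p) ≤
        min (LamNorm l p (x + y)) (LamNorm l p (x - y)) := by
  have hp0 : 0 < p := by linarith
  set S : ℕ → ℝ := fun m => ∑' n, l (n + m) ^ (-p) with hSdef
  have ha : ∀ n, 0 < l n ^ (-p) := fun n => Real.rpow_pos_of_pos (hpos n) _
  have hsm : ∀ m, Summable fun n => l (n + m) ^ (-p) := fun m =>
    (summable_nat_add_iff (f := fun n => l n ^ (-p)) m).2 hsum
  have hS : ∀ m, 0 < S m := fun m => (hsm m).tsum_pos (fun n => (ha _).le) 0 (ha _)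
  have hSle : S (m + 1) ≤ S m := by
    have : S m = l m ^ (-p) + S (m + 1) := by
      simp only [hSdef]
      rw [(hsm m).tsum_eq_zero_add]
      simp [add_assoc, add_comm 1 m]
    linarith [ha m]
  set s : ℕ → ℝ := fun m => S m ^ (-(1 / p)) with hsdef
  have hs0 : ∀ m, 0 < s m := fun m => Real.rpow_pos_of_pos (hS m) _
  have hsp : ∀ m, s m ^ p = (S m)⁻¹ := fun m => by
    rw [hsdef, ← Real.rpow_mul (hS m).le, neg_mul, one_div_mul_cancel hp0.ne',
      Real.rpow_neg_one]
  have hdivp : ∀ {c : ℝ}, 0 ≤ c → ∀ n, (c / l n) ^ p = c ^ p * l n ^ (-p) := fun hc n => by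
    rw [Real.div_rpow hc (hpos n).le, Real.rpow_neg (hpos n).le, div_eq_mul_inv]
  let e : ℕ → ℕ → ℝ := fun m => Pi.single m (s m / dLam l m)
  have he : ∀ m n, LamAvg l (e m) n = if m ≤ n then s m / l n else 0 := fun m n => by
    have hd := dLam_pos hpos hmono m
    rw [LamAvg_single, abs_of_pos (div_pos (hs0 m) hd), mul_div_cancel₀ _ hd.ne']
  have hetail : ∀ m n, LamAvg l (e m) (n + m) ^ p = (S m)⁻¹ * l (n + m) ^ (-p) := fun m n => by
    rw [he, if_pos (by omega), hdivp (hs0 m).le, hsp]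
  have hesum : ∀ m, Summable fun n => LamAvg l (e m) n ^ p := fun m => by
    rw [← summable_nat_add_iff m]
    simp only [hetail]
    exact (hsm m).mul_left _
  have henorm : ∀ m, LamNorm l p (e m) = 1 := fun m => by
    have hzero : ∑ n ∈ Finset.range m, LamAvg l (e m) n ^ p = 0 :=
      Finset.sum_eq_zero fun n hn => by
        rw [he, if_neg (by simpa using hn), Real.zero_rpow hp0.ne']
    rw [LamNorm, ← (hesum m).sum_add_tsum_nat_add m, hzero, zero_add]
    simp only [hetail]
    rw [tsum_mul_left, inv_mul_cancel₀ (hS m).ne', Real.one_rpow]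
  have key : ∀ z : ℕ → ℝ, (∀ k, |z k| = |e m k| + |e (m + 1) k|) →
      2 * (S (m + 1) / S m) ^ (1 / p) ≤ LamNorm l p z := by
    intro z hz
    have hzs := (summable_and_LamNorm_le_add hpos hmono hp (fun k => (hz k).le)
      (hesum m) (hesum (m + 1))).1
    have hnn : ∀ n, 0 ≤ LamAvg l z n ^ p := fun n =>
      Real.rpow_nonneg (LamAvg_nonneg hpos hmono z n) p
    have hterm : ∀ n, 2 ^ p * (S m)⁻¹ * l (n + (m + 1)) ^ (-p) ≤
        LamAvg l z (n + (m + 1)) ^ p := by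
      intro n
      have hss : s m ≤ s (m + 1) :=
        Real.rpow_le_rpow_of_nonpos (hS _) hSle (neg_nonpos.2 (by positivity))
      rw [← hsp, ← Real.mul_rpow zero_le_two (hs0 m).le,
        ← hdivp (mul_nonneg zero_le_two (hs0 m).le), LamAvg_eq_add hz, he, he,
        if_pos (by omega), if_pos (by omega), ← add_div]
      have hl := hpos (n + (m + 1))
      have := hs0 m
      gcongr
      linarith
    have htail : 2 ^ p * (S (m + 1) / S m) ≤ ∑' n, LamAvg l z n ^ p := by
      rw [← hzs.sum_add_tsum_nat_add (m + 1)]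
      have h1 := ((hsm (m + 1)).mul_left (2 ^ p * (S m)⁻¹)).tsum_le_tsum hterm
        ((summable_nat_add_iff (m + 1)).2 hzs)
      rw [tsum_mul_left] at h1
      have h2 : 0 ≤ ∑ n ∈ Finset.range (m + 1), LamAvg l z n ^ p :=
        Finset.sum_nonneg fun n _ => hnn n
      calc 2 ^ p * (S (m + 1) / S m) = 2 ^ p * (S m)⁻¹ * S (m + 1) := by ring
        _ ≤ _ := h1
        _ ≤ _ := le_add_of_nonneg_left h2
    have hquot : 0 ≤ S (m + 1) / S m := (div_pos (hS _) (hS _)).le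
    calc 2 * (S (m + 1) / S m) ^ (1 / p)
        = (2 ^ p * (S (m + 1) / S m)) ^ (1 / p) := by
          rw [Real.mul_rpow (by positivity) hquot, ← Real.rpow_mul zero_le_two,
            mul_one_div_cancel hp0.ne', Real.rpow_one]
      _ ≤ _ := Real.rpow_le_rpow (by positivity) htail (by positivity)
  have hdisj : ∀ k, e m k = 0 ∨ e (m + 1) k = 0 := fun k => by
    by_cases hk : k = m
    · exact .inr (Pi.single_eq_of_ne (by omega) _)
    · exact .inl (Pi.single_eq_of_ne hk _)
  refine ⟨e m, e (m + 1), henorm m, henorm (m + 1), le_min (key _ fun k => ?_) (key _ fun k => ?_)⟩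
  · rcases hdisj k with h | h <;> simp [h]
  · rcases hdisj k with h | h <;> simp [h]

/-- The James constant of `Λ_p` equals 2 for `1 < p < ∞`. -/
theorem james_constant_LamP_eq_two (l : ℕ → ℝ) (p : ℝ)
    (hpos : ∀ k, 0 < l k) (hmono : StrictMono l)
    (htop : Tendsto l atTop atTop)
    (hratio : Tendsto (fun k => l (k + 1) / l k) atTop (𝓝 1))
    (hp : 1 < p)
    (hsum : Summable fun n => (l n) ^ (-p)) :
    sSup {r : ℝ | ∃ x y : ℕ → ℝ, LamNorm l p x = 1 ∧ LamNorm l p y = 1 ∧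
      r = min (LamNorm l p (x + y)) (LamNorm l p (x - y))} = 2 := by
  have key : ∀ w < (2 : ℝ), ∃ x y : ℕ → ℝ, LamNorm l p x = 1 ∧ LamNorm l p y = 1 ∧
      w < min (LamNorm l p (x + y)) (LamNorm l p (x - y)) := by
    intro w hw
    have hr : Tendsto (fun n => l (n + 1) ^ (-p) / l n ^ (-p)) atTop (𝓝 1) := by
      have := hratio.rpow_const (p := -p) (Or.inl one_ne_zero)
      rw [Real.one_rpow] at this
      exact this.congr fun n => Real.div_rpow (hpos _).le (hpos _).le _
    have ht := tendsto_tail_ratio (fun n => Real.rpow_pos_of_pos (hpos n) (-p)) hsum hr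
    have hlim := (ht.rpow_const (p := 1 / p) (Or.inl one_ne_zero)).const_mul 2
    rw [Real.one_rpow, mul_one] at hlim
    obtain ⟨m, hm⟩ := (hlim.eventually_const_lt hw).exists
    obtain ⟨x, y, hx, hy, hxy⟩ := exists_unit_min_ge hpos hmono hp hsum m
    exact ⟨x, y, hx, hy, hm.trans_le hxy⟩
  refine csSup_eq_of_forall_le_of_forall_lt_exists_gt ?_ ?_ ?_
  · obtain ⟨x, y, hx, hy, -⟩ := key 0 two_pos
    exact ⟨_, x, y, hx, hy, rfl⟩
  · rintro r ⟨x, y, hx, hy, rfl⟩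
    have h := (summable_and_LamNorm_le_add hpos hmono hp (z := x + y)
      (fun k => abs_add_le (x k) (y k)) (summable_of_LamNorm_eq_one hp hx)
      (summable_of_LamNorm_eq_one hp hy)).2
    exact (min_le_left _ _).trans (by linarith)
  · intro w hw
    obtain ⟨x, y, hx, hy, hxy⟩ := key w hw
    exact ⟨_, ⟨x, y, hx, hy, rfl⟩, hxy⟩
end

section
/- The James constant of Λ_∞ equals 2; that is, sup{ min(‖x+y‖_∞, ‖x−y‖_∞) : x, y real sequences with ‖x‖_∞ = ‖y‖_∞ = 1 } = 2. -/
open Filter Topology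

/-- The norm of the space `Λ_∞`, `‖x‖_∞ = sup_n Λx(n)`. -/
noncomputable def LamNormInf (l : ℕ → ℝ) (x : ℕ → ℝ) : ℝ :=
  ⨆ n : ℕ, LamAvg l x n

/-- A sequence of norm `1` has averages bounded by `1`: an unbounded family would have the
supremum `0`. -/
lemma LamAvg_le_one {l x : ℕ → ℝ} (hx : LamNormInf l x = 1) (n : ℕ) : LamAvg l x n ≤ 1 := by
  have hb : BddAbove (Set.range (LamAvg l x)) := by
    by_contra hb
    have h0 : LamNormInf l x = 0 := Real.iSup_of_not_bddAbove hb
    linarith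
  exact hx ▸ le_ciSup hb n

lemma LamAvg_le_two {l : ℕ → ℝ} (hpos : ∀ k, 0 < l k) (hmono : StrictMono l)
    {x y z : ℕ → ℝ} (hx : LamNormInf l x = 1) (hy : LamNormInf l y = 1)
    (h : ∀ k, |z k| ≤ |x k| + |y k|) (n : ℕ) : LamAvg l z n ≤ 2 := by
  linarith [LamAvg_le_add hpos hmono h n, LamAvg_le_one hx n, LamAvg_le_one hy n]

/-- The sequence supported at the single index `m` and normalized in `Λ_∞`. -/
noncomputable def LamSpike (l : ℕ → ℝ) (m : ℕ) : ℕ → ℝ :=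
  Pi.single m (l m / dLam l m)

lemma LamAvg_LamSpike {l : ℕ → ℝ} (hpos : ∀ k, 0 < l k) (hmono : StrictMono l) (m n : ℕ) :
    LamAvg l (LamSpike l m) n = if m ≤ n then l m / l n else 0 := by
  have hd := dLam_pos hpos hmono m
  have hterm : ∀ k, dLam l k * |LamSpike l m k| = if k = m then l m else 0 := by
    intro k
    unfold LamSpike
    split_ifs with h
    · subst h
      rw [Pi.single_eq_same, abs_of_pos (div_pos (hpos k) hd), mul_div_cancel₀ _ hd.ne']
    · rw [Pi.single_eq_of_ne h, abs_zero, mul_zero]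
  unfold LamAvg
  simp only [hterm, Finset.sum_ite_eq', Finset.mem_range, Nat.lt_succ_iff]
  split_ifs
  · rw [one_div_mul_eq_div]
  · rw [mul_zero]

lemma LamNormInf_LamSpike {l : ℕ → ℝ} (hpos : ∀ k, 0 < l k) (hmono : StrictMono l) (m : ℕ) :
    LamNormInf l (LamSpike l m) = 1 := by
  have hle : ∀ n, LamAvg l (LamSpike l m) n ≤ 1 := by
    intro n
    rw [LamAvg_LamSpike hpos hmono]
    split_ifs with h
    · exact (div_le_one (hpos n)).2 (hmono.monotone h)
    · exact zero_le_one
  refine le_antisymm (ciSup_le hle) ?_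
  have h := le_ciSup (f := LamAvg l (LamSpike l m)) ⟨1, Set.forall_mem_range.2 hle⟩ m
  rwa [LamAvg_LamSpike hpos hmono, if_pos le_rfl, div_self (hpos m).ne'] at h

lemma one_add_div_le_LamNormInf {l : ℕ → ℝ} (hpos : ∀ k, 0 < l k) (hmono : StrictMono l)
    (m : ℕ) {z : ℕ → ℝ} (hz : ∀ k, |z k| = |LamSpike l m k| + |LamSpike l (m + 1) k|) :
    1 + l m / l (m + 1) ≤ LamNormInf l z := by
  have hb : BddAbove (Set.range (LamAvg l z)) :=
    ⟨2, Set.forall_mem_range.2 <| LamAvg_le_two hpos hmono (LamNormInf_LamSpike hpos hmono m)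
      (LamNormInf_LamSpike hpos hmono (m + 1)) fun k => (hz k).le⟩
  have hsum : LamAvg l z (m + 1) =
      LamAvg l (LamSpike l m) (m + 1) + LamAvg l (LamSpike l (m + 1)) (m + 1) := by
    simp only [LamAvg, hz, mul_add, Finset.sum_add_distrib]
  rw [LamAvg_LamSpike hpos hmono, LamAvg_LamSpike hpos hmono, if_pos m.le_succ, if_pos le_rfl,
    div_self (hpos (m + 1)).ne'] at hsum
  rw [add_comm 1 (l m / _), ← hsum]
  exact le_ciSup hb (m + 1)

/-- The James constant of `Λ_∞` equals 2. -/
theorem james_constant_LamInf_eq_two (l : ℕ → ℝ)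
    (hpos : ∀ k, 0 < l k) (hmono : StrictMono l)
    (htop : Tendsto l atTop atTop)
    (hratio : Tendsto (fun k => l (k + 1) / l k) atTop (𝓝 1)) :
    sSup {r : ℝ | ∃ x y : ℕ → ℝ, LamNormInf l x = 1 ∧ LamNormInf l y = 1 ∧
      r = min (LamNormInf l (x + y)) (LamNormInf l (x - y))} = 2 := by
  have hub : ∀ r ∈ {r : ℝ | ∃ x y : ℕ → ℝ, LamNormInf l x = 1 ∧ LamNormInf l y = 1 ∧
      r = min (LamNormInf l (x + y)) (LamNormInf l (x - y))}, r ≤ 2 := by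
    rintro r ⟨x, y, hx, hy, rfl⟩
    exact (min_le_left _ _).trans
      (ciSup_le (LamAvg_le_two hpos hmono hx hy fun k => abs_add_le (x k) (y k)))
  have hspike : ∀ m, 1 + l m / l (m + 1) ≤
      sSup {r : ℝ | ∃ x y : ℕ → ℝ, LamNormInf l x = 1 ∧ LamNormInf l y = 1 ∧
        r = min (LamNormInf l (x + y)) (LamNormInf l (x - y))} := by
    intro m
    have hdisj : ∀ k, LamSpike l m k = 0 ∨ LamSpike l (m + 1) k = 0 := by
      intro k
      by_cases h : k = m
      · exact Or.inr (Pi.single_eq_of_ne (by omega) _)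
      · exact Or.inl (Pi.single_eq_of_ne h _)
    refine le_trans (le_min ?_ ?_) (le_csSup ⟨2, hub⟩ ⟨LamSpike l m, LamSpike l (m + 1),
      LamNormInf_LamSpike hpos hmono m, LamNormInf_LamSpike hpos hmono (m + 1), rfl⟩) <;>
    · refine one_add_div_le_LamNormInf hpos hmono m fun k => ?_
      rcases hdisj k with h | h <;> simp [h]
  have hlim : Tendsto (fun m => 1 + l m / l (m + 1)) atTop (𝓝 2) := by
    have h := (hratio.inv₀ one_ne_zero).const_add 1
    simp only [inv_div, inv_one, one_add_one_eq_two] at h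
    exact h
  exact le_antisymm (Real.sSup_le hub zero_le_two) (le_of_tendsto' hlim hspike)
end

section
/- Let 1 < p < ∞ with ∑_{n=0}^∞ λ_n^{-p} < ∞, and let i, r be natural numbers with i ≤ r. Then lim_{m→∞} λ_{m+i}^{-p} / ( ∑_{j=m+r}^∞ λ_j^{-p} ) = 0. In particular (i = 0, r = 1), lim_{m→∞} λ_m^{-p} / ( ∑_{n=m+1}^∞ λ_n^{-p} ) = 0. -/
open Filter Topology

/-- If consecutive ratios tend to `1`, so do the ratios of terms at bounded distance. -/
lemma tendsto_shift_div_of_tendsto_succ_div {a : ℕ → ℝ} (ha : ∀ n, 0 < a n)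
    (h : Tendsto (fun n => a (n + 1) / a n) atTop (𝓝 1)) (s t : ℕ) :
    Tendsto (fun m => a (m + s) / a (m + t)) atTop (𝓝 1) := by
  have key : ∀ s : ℕ, Tendsto (fun m => a (m + s) / a m) atTop (𝓝 1) := by
    intro s
    induction s with
    | zero => simp [div_self (ha _).ne']
    | succ s ih =>
      have h' := (h.comp (tendsto_add_atTop_nat s)).mul ih
      rw [one_mul] at h'
      refine h'.congr fun m => ?_
      exact div_mul_div_cancel₀ (ha (m + s)).ne'
  have h' := (key s).div (key t) one_ne_zero
  rw [div_one] at h'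
  refine h'.congr fun m => ?_
  exact div_div_div_cancel_right₀ (ha m).ne' _ _

/-- If consecutive ratios of a positive summable sequence tend to `1`, then its terms are
negligible compared with its tails. -/
lemma tendsto_div_tsum_tail_of_tendsto_succ_div {a : ℕ → ℝ} (ha : ∀ n, 0 < a n)
    (h : Tendsto (fun n => a (n + 1) / a n) atTop (𝓝 1)) (hs : Summable a) (i r : ℕ) :
    Tendsto (fun m => a (m + i) / ∑' j : ℕ, a (m + r + j)) atTop (𝓝 0) := by
  suffices H : Tendsto (fun m => (∑' j : ℕ, a (m + r + j)) / a (m + i)) atTop atTop from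
    H.inv_tendsto_atTop.congr fun m => inv_div _ _
  refine tendsto_atTop.2 fun b => ?_
  obtain ⟨K, hK⟩ := exists_nat_gt b
  have hlim : Tendsto (fun m => ∑ j ∈ Finset.range K, a (m + (r + j)) / a (m + i))
      atTop (𝓝 K) := by
    simpa using tendsto_finsetSum (Finset.range K) fun j _ =>
      tendsto_shift_div_of_tendsto_succ_div ha h (r + j) i
  filter_upwards [hlim.eventually_const_lt hK] with m hm
  refine hm.le.trans ?_
  rw [← Finset.sum_div]
  refine div_le_div_of_nonneg_right ?_ (ha _).le
  simp only [← add_assoc]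
  exact (hs.comp_injective (add_right_injective (m + r))).sum_le_tsum _ fun j _ => (ha _).le

/-- Bernoulli–de l'Hospital type limit:
`λ_{m+i}^{-p} / ∑_{j=m+r}^∞ λ_j^{-p} → 0` as `m → ∞`, whenever `i ≤ r`. -/
theorem tail_ratio_tendsto_zero (l : ℕ → ℝ) (p : ℝ) (i r : ℕ)
    (hpos : ∀ k, 0 < l k) (hmono : StrictMono l)
    (htop : Tendsto l atTop atTop)
    (hratio : Tendsto (fun k => l (k + 1) / l k) atTop (𝓝 1))
    (hp : 1 < p)
    (hsum : Summable fun n => (l n) ^ (-p))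
    (hir : i ≤ r) :
    Tendsto (fun m : ℕ => (l (m + i)) ^ (-p) / ∑' j : ℕ, (l (m + r + j)) ^ (-p))
      atTop (𝓝 0) := by
  refine tendsto_div_tsum_tail_of_tendsto_succ_div (a := fun n => l n ^ (-p))
    (fun n => Real.rpow_pos_of_pos (hpos n) _) ?_ hsum i r
  have h := hratio.rpow_const (p := -p) (Or.inl one_ne_zero)
  rw [Real.one_rpow] at h
  exact h.congr fun n => Real.div_rpow (hpos _).le (hpos _).le _
end

section
/- Let 1 < p < ∞ with ∑_{n=0}^∞ λ_n^{-p} < ∞. For m ∈ ℕ let e_m denote the sequence with 1 in position m and 0 elsewhere, so that ‖e_m‖_p = (λ_m − λ_{m−1})(∑_{n=m}^∞ λ_n^{-p})^{1/p}. Then for every m ∈ ℕ and every integer n ≥ 1, one has n ≥ ‖∑_{j=0}^{n−1} e_{m+j}/‖e_{m+j}‖_p‖_p ≥ n · [(λ_m − λ_{m−1})/(λ_{m+n−1} − λ_{m+n−2})] · (‖e_{m+n−1}‖_p / ‖e_m‖_p). -/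
open Filter Topology

/-- The `m`-th unit vector: 1 in position `m`, 0 elsewhere. -/
noncomputable def unitVec (m : ℕ) : ℕ → ℝ := fun k => if k = m then 1 else 0

lemma LamAvg_unitVec (l : ℕ → ℝ) (m n : ℕ) :
    LamAvg l (unitVec m) n = if m ≤ n then dLam l m * (l n)⁻¹ else 0 := by
  have h (k : ℕ) : dLam l k * |unitVec m k| = if k = m then dLam l k else 0 := by
    unfold unitVec
    split_ifs <;> simp
  simp only [LamAvg, h, Finset.sum_ite_eq', Finset.mem_range, Nat.lt_succ_iff]
  split_ifs <;> simp [mul_comm]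

lemma LamAvg_sum_unitVec_div (l : ℕ → ℝ) {c : ℕ → ℝ} (hc : ∀ j, 0 ≤ c j) (i : ℕ → ℕ)
    (s : Finset ℕ) (n : ℕ) :
    LamAvg l (fun k => ∑ j ∈ s, unitVec (i j) k / c j) n =
      ∑ j ∈ s, LamAvg l (unitVec (i j)) n / c j := by
  have h0 (m k : ℕ) : 0 ≤ unitVec m k := by unfold unitVec; split_ifs <;> norm_num
  have h (k : ℕ) : |∑ j ∈ s, unitVec (i j) k / c j| = ∑ j ∈ s, |unitVec (i j) k| / c j := by
    rw [abs_of_nonneg (Finset.sum_nonneg fun j _ => div_nonneg (h0 _ _) (hc j))]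
    simp only [abs_of_nonneg (h0 _ _)]
  simp only [LamAvg, h, Finset.mul_sum, Finset.sum_div]
  rw [Finset.sum_comm]
  refine Finset.sum_congr rfl fun j _ => Finset.sum_congr rfl fun k _ => ?_
  ring

/-- A sequence vanishing below `m` is summed by its shift. -/
lemma hasSum_of_hasSum_add {f : ℕ → ℝ} {m : ℕ} {a : ℝ} (h0 : ∀ n < m, f n = 0)
    (h : HasSum (fun n => f (m + n)) a) : HasSum f a := by
  refine ((add_right_injective m).hasSum_iff fun n hn => h0 n ?_).1 h
  by_contra! hmn
  exact hn ⟨n - m, Nat.add_sub_cancel' hmn⟩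

lemma hasSum_LamAvg_unitVec_rpow {l : ℕ → ℝ} {p : ℝ} (hpos : ∀ k, 0 < l k)
    (hmono : StrictMono l) (hp : 0 < p) (hsum : Summable fun n => (l n) ^ (-p)) (m : ℕ) :
    HasSum (fun n => (LamAvg l (unitVec m) n) ^ p)
      (dLam l m ^ p * ∑' n : ℕ, (l (m + n)) ^ (-p)) := by
  refine hasSum_of_hasSum_add (m := m) (fun n hn => ?_) ?_
  · rw [LamAvg_unitVec, if_neg hn.not_ge, Real.zero_rpow hp.ne']
  · have h : Summable fun n => (l (m + n)) ^ (-p) := hsum.comp_injective (add_right_injective m)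
    refine (h.hasSum.mul_left (dLam l m ^ p)).congr_fun fun n => ?_
    rw [LamAvg_unitVec, if_pos (Nat.le_add_right m n),
      Real.mul_rpow (dLam_pos hpos hmono m).le (inv_nonneg.2 (hpos _).le),
      Real.inv_rpow (hpos _).le, Real.rpow_neg (hpos _).le]

lemma tsum_shift_rpow_pos {l : ℕ → ℝ} {p : ℝ} (hpos : ∀ k, 0 < l k)
    (hsum : Summable fun n => (l n) ^ (-p)) (m : ℕ) : 0 < ∑' n : ℕ, (l (m + n)) ^ (-p) :=
  (hsum.comp_injective (add_right_injective m)).tsum_pos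
    (fun _ => (Real.rpow_pos_of_pos (hpos _) _).le) 0 (Real.rpow_pos_of_pos (hpos _) _)

lemma tsum_shift_rpow_antitone {l : ℕ → ℝ} {p : ℝ} (hpos : ∀ k, 0 < l k)
    (hsum : Summable fun n => (l n) ^ (-p)) :
    Antitone fun m => ∑' n : ℕ, (l (m + n)) ^ (-p) := by
  refine antitone_nat_of_succ_le fun m => ?_
  have h : Summable fun n => (l (m + n)) ^ (-p) := hsum.comp_injective (add_right_injective m)
  rw [h.tsum_eq_zero_add]
  have h1 : 0 ≤ l (m + 0) ^ (-p) := (Real.rpow_pos_of_pos (hpos _) _).le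
  simpa [add_assoc, add_comm, add_left_comm] using h1

lemma LamNorm_unitVec {l : ℕ → ℝ} {p : ℝ} (hpos : ∀ k, 0 < l k) (hmono : StrictMono l)
    (hp : 0 < p) (hsum : Summable fun n => (l n) ^ (-p)) (m : ℕ) :
    LamNorm l p (unitVec m) = dLam l m * (∑' n : ℕ, (l (m + n)) ^ (-p)) ^ (1 / p) := by
  have hd := (dLam_pos hpos hmono m).le
  rw [LamNorm, (hasSum_LamAvg_unitVec_rpow hpos hmono hp hsum m).tsum_eq,
    Real.mul_rpow (Real.rpow_nonneg hd _) (tsum_shift_rpow_pos hpos hsum m).le,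
    one_div, Real.rpow_rpow_inv hd hp.ne']

/-- Formula for `‖e_m‖_p` and the key two-sided estimate for
`‖∑_{j=0}^{n−1} e_{m+j}/‖e_{m+j}‖_p‖_p`. -/
theorem unitVec_norm_and_estimate (l : ℕ → ℝ) (p : ℝ)
    (hpos : ∀ k, 0 < l k) (hmono : StrictMono l)
    (htop : Tendsto l atTop atTop)
    (hratio : Tendsto (fun k => l (k + 1) / l k) atTop (𝓝 1))
    (hp : 1 < p)
    (hsum : Summable fun n => (l n) ^ (-p)) :
    (∀ m : ℕ, LamNorm l p (unitVec m) =
      dLam l m * (∑' n : ℕ, (l (m + n)) ^ (-p)) ^ (1 / p)) ∧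
    (∀ m n : ℕ, 1 ≤ n →
      LamNorm l p
        (fun k => ∑ j ∈ Finset.range n, unitVec (m + j) k / LamNorm l p (unitVec (m + j)))
        ≤ (n : ℝ) ∧
      (n : ℝ) * (dLam l m / dLam l (m + (n - 1))) *
          (LamNorm l p (unitVec (m + (n - 1))) / LamNorm l p (unitVec m)) ≤
        LamNorm l p
          (fun k => ∑ j ∈ Finset.range n, unitVec (m + j) k / LamNorm l p (unitVec (m + j)))) := by
  have hp0 : 0 < p := one_pos.trans hp
  have hd := dLam_pos hpos hmono
  have hT := tsum_shift_rpow_pos hpos hsum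
  have hN (m : ℕ) := LamNorm_unitVec hpos hmono hp0 hsum m
  refine ⟨hN, fun m n hn => ?_⟩
  have hNpos (i : ℕ) : 0 < LamNorm l p (unitVec i) := by
    rw [hN]
    exact mul_pos (hd i) (Real.rpow_pos_of_pos (hT i) _)
  set g : ℕ → ℕ → ℝ := fun j k =>
    LamAvg l (unitVec (m + j)) k / LamNorm l p (unitVec (m + j)) with hg
  have hg0 (j k : ℕ) : 0 ≤ g j k := by
    refine div_nonneg ?_ (hNpos _).le
    rw [LamAvg_unitVec]
    split_ifs
    exacts [mul_nonneg (hd _).le (inv_nonneg.2 (hpos _).le), le_rfl]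
  have hg1 (j : ℕ) : HasSum (fun k => g j k ^ p) 1 := by
    have h := (hasSum_LamAvg_unitVec_rpow hpos hmono hp0 hsum (m + j)).div_const
      (LamNorm l p (unitVec (m + j)) ^ p)
    have h1 : LamNorm l p (unitVec (m + j)) ^ p =
        dLam l (m + j) ^ p * ∑' n : ℕ, (l (m + j + n)) ^ (-p) := by
      rw [hN, Real.mul_rpow (hd _).le (Real.rpow_nonneg (hT _).le _), one_div,
        Real.rpow_inv_rpow (hT _).le hp0.ne']
    rw [← h1, div_self (Real.rpow_pos_of_pos (hNpos _) _).ne'] at h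
    refine h.congr_fun fun k => ?_
    refine Real.div_rpow ?_ (hNpos _).le _
    have h2 := mul_nonneg (hg0 j k) (hNpos (m + j)).le
    rwa [hg, div_mul_cancel₀ _ (hNpos _).ne'] at h2
  have hpow (k : ℕ) : (∑ j ∈ Finset.range n, g j k) ^ p ≤
      (n : ℝ) ^ (p - 1) * ∑ j ∈ Finset.range n, g j k ^ p := by
    have h := Real.rpow_sum_le_const_mul_sum_rpow (Finset.range n) (fun j => g j k) hp.le
    simpa only [abs_of_nonneg (hg0 _ _), Finset.card_range] using h
  have hbound : HasSum (fun k => (n : ℝ) ^ (p - 1) * ∑ j ∈ Finset.range n, g j k ^ p)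
      ((n : ℝ) ^ p) := by
    have hn0 : (0 : ℝ) < n := by exact_mod_cast hn
    have h := (hasSum_sum fun j (_ : j ∈ Finset.range n) => hg1 j).mul_left ((n : ℝ) ^ (p - 1))
    rwa [Finset.sum_const, Finset.card_range, nsmul_one, ← Real.rpow_add_one hn0.ne',
      sub_add_cancel] at h
  have hx0 (k : ℕ) : 0 ≤ ∑ j ∈ Finset.range n, g j k := Finset.sum_nonneg fun j _ => hg0 j k
  have hxsum : Summable fun k => (∑ j ∈ Finset.range n, g j k) ^ p :=
    hbound.summable.of_nonneg_of_le (fun k => Real.rpow_nonneg (hx0 k) _) hpow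
  have hx : LamNorm l p (fun k => ∑ j ∈ Finset.range n,
      unitVec (m + j) k / LamNorm l p (unitVec (m + j))) =
      (∑' k, (∑ j ∈ Finset.range n, g j k) ^ p) ^ (1 / p) := by
    conv_lhs => unfold LamNorm
    congr 2 with k
    congr 1
    exact LamAvg_sum_unitVec_div l (fun j => (hNpos (m + j)).le) _ _ k
  rw [hx]
  constructor
  · rw [one_div, Real.rpow_inv_le_iff_of_pos (tsum_nonneg fun k => Real.rpow_nonneg (hx0 k) _)
      n.cast_nonneg hp0]
    exact hbound.tsum_eq ▸ hxsum.tsum_le_tsum hpow hbound.summable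
  · have hS (i : ℕ) : 0 < (∑' n : ℕ, (l (i + n)) ^ (-p)) ^ (1 / p) :=
      Real.rpow_pos_of_pos (hT i) _
    set q := m + (n - 1) with hq
    set S : ℕ → ℝ := fun i => (∑' n : ℕ, (l (i + n)) ^ (-p)) ^ (1 / p) with hSdef
    have hlhs : (n : ℝ) * (dLam l m / dLam l q) *
        (LamNorm l p (unitVec q) / LamNorm l p (unitVec m)) = n / S m * S q := by
      rw [hN, hN]
      have h1 := (hd m).ne'
      have h2 := (hd q).ne'
      have h3 := (hS m).ne'
      simp only [hSdef]
      field_simp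
    have hSle (j : ℕ) : S (m + j) ≤ S m :=
      Real.rpow_le_rpow (hT _).le (tsum_shift_rpow_antitone hpos hsum (Nat.le_add_right m j))
        (by positivity)
    have hlow (k : ℕ) : n / S m * (l (q + k))⁻¹ ≤ ∑ j ∈ Finset.range n, g j (q + k) := by
      have h : ∀ j ∈ Finset.range n, (S m)⁻¹ * (l (q + k))⁻¹ ≤ g j (q + k) := by
        intro j hj
        have hj' : m + j ≤ q + k := by
          have := Finset.mem_range.1 hj
          omega
        have hgj : g j (q + k) = (S (m + j))⁻¹ * (l (q + k))⁻¹ := by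
          simp only [hg, LamAvg_unitVec, if_pos hj', hN]
          have h1 := (hd (m + j)).ne'
          have h3 := (hS (m + j)).ne'
          have h4 := (hpos (q + k)).ne'
          simp only [hSdef]
          field_simp
        rw [hgj]
        exact mul_le_mul_of_nonneg_right (inv_anti₀ (hS _) (hSle j)) (inv_nonneg.2 (hpos _).le)
      have h' := Finset.card_nsmul_le_sum _ _ _ h
      rwa [Finset.card_range, nsmul_eq_mul, ← mul_assoc, ← div_eq_mul_inv] at h'
    have hc : 0 ≤ n / S m := div_nonneg n.cast_nonneg (hS m).le
    rw [hlhs, one_div, Real.le_rpow_inv_iff_of_pos (mul_nonneg hc (hS q).le)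
      (tsum_nonneg fun k => Real.rpow_nonneg (hx0 k) _) hp0, Real.mul_rpow hc (hS q).le]
    have hSq : S q ^ p = ∑' k : ℕ, (l (q + k)) ^ (-p) := by
      simp only [hSdef, one_div]
      exact Real.rpow_inv_rpow (hT _).le hp0.ne'
    rw [hSq, ← tsum_mul_left]
    refine le_trans ?_ (tsum_comp_le_tsum_of_inj hxsum
      (fun k => Real.rpow_nonneg (hx0 k) _) (add_right_injective q))
    refine Summable.tsum_le_tsum (fun k => ?_)
      ((hsum.comp_injective (add_right_injective q)).mul_left _)
      (hxsum.comp_injective (add_right_injective q))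
    rw [Real.rpow_neg (hpos _).le, ← Real.inv_rpow (hpos _).le,
      ← Real.mul_rpow hc (inv_nonneg.2 (hpos _).le)]
    exact Real.rpow_le_rpow (mul_nonneg hc (inv_nonneg.2 (hpos _).le)) (hlow k) hp0.le
end

section
/- If x ∈ Λ_{p̂} with ‖x‖_{p̂} = 1 is an extreme point of the closed unit ball B(Λ_{p̂}) = {y ∈ Λ_{p̂} : ‖y‖_{p̂} ≤ 1} (i.e., there do not exist y, z ∈ B(Λ_{p̂}) with y ≠ z and 2x = y + z), then σ(x) = 1. -/
open Filter Topology

/-- The modular `σ(x) = ∑_{n=0}^∞ (Λx(n))^{p_n}`. -/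
noncomputable def sigmaMod (l pp : ℕ → ℝ) (x : ℕ → ℝ) : ℝ :=
  ∑' n : ℕ, (LamAvg l x n) ^ (pp n)

/-- The modular of `x` is finite (the defining series converges). -/
def FiniteMod (l pp : ℕ → ℝ) (x : ℕ → ℝ) : Prop :=
  Summable fun n : ℕ => (LamAvg l x n) ^ (pp n)

/-- Membership in `Λ_{p̂}` : `σ(rx) < ∞` for some `r > 0`. -/
def MemLam (l pp : ℕ → ℝ) (x : ℕ → ℝ) : Prop :=
  ∃ r : ℝ, 0 < r ∧ FiniteMod l pp (fun k => r * x k)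

/-- The Luxemburg norm `‖x‖_{p̂} = inf { r > 0 : σ(x/r) ≤ 1 }`. -/
noncomputable def luxNorm (l pp : ℕ → ℝ) (x : ℕ → ℝ) : ℝ :=
  sInf {r : ℝ | 0 < r ∧ FiniteMod l pp (fun k => x k / r) ∧
    sigmaMod l pp (fun k => x k / r) ≤ 1}

lemma LamAvg_const_mul (l : ℕ → ℝ) {t : ℝ} (ht : 0 ≤ t) (x : ℕ → ℝ) (n : ℕ) :
    LamAvg l (fun k => t * x k) n = t * LamAvg l x n := by
  simp only [LamAvg, abs_mul, abs_of_nonneg ht, mul_left_comm _ t, ← Finset.mul_sum]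

/-- With exponents bounded by `M`, dilating by `t ≥ 1` increases the modular by a factor of at
most `t ^ M`. -/
lemma finiteMod_and_sigmaMod_const_mul_le {l pp : ℕ → ℝ} (hpos : ∀ k, 0 < l k)
    (hmono : StrictMono l) {M : ℝ} (hM : ∀ n, pp n ≤ M) {t : ℝ} (ht : 1 ≤ t) {x : ℕ → ℝ}
    (hx : FiniteMod l pp x) :
    FiniteMod l pp (fun k => t * x k) ∧
      sigmaMod l pp (fun k => t * x k) ≤ t ^ M * sigmaMod l pp x := by
  have ht0 : 0 ≤ t := zero_le_one.trans ht
  have hA := LamAvg_nonneg hpos hmono x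
  have hle (n : ℕ) : LamAvg l (fun k => t * x k) n ^ pp n ≤ t ^ M * LamAvg l x n ^ pp n := by
    rw [LamAvg_const_mul l ht0, Real.mul_rpow ht0 (hA n)]
    exact mul_le_mul_of_nonneg_right (Real.rpow_le_rpow_of_exponent_le ht (hM n))
      (Real.rpow_nonneg (hA n) _)
  have hsum : Summable fun n => t ^ M * LamAvg l x n ^ pp n := Summable.mul_left _ hx
  have hfin : FiniteMod l pp (fun k => t * x k) :=
    hsum.of_nonneg_of_le
      (fun n => Real.rpow_nonneg (LamAvg_nonneg hpos hmono _ n) _) hle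
  refine ⟨hfin, ?_⟩
  rw [sigmaMod, sigmaMod, ← tsum_mul_left]
  exact Summable.tsum_le_tsum hle hfin hsum

/-- With bounded exponents, every vector of Luxemburg norm one has modular one. -/
lemma sigmaMod_eq_one_of_luxNorm_eq_one {l pp : ℕ → ℝ} (hpos : ∀ k, 0 < l k)
    (hmono : StrictMono l) {M : ℝ} (hM : ∀ n, pp n ≤ M) {x : ℕ → ℝ}
    (hnorm : luxNorm l pp x = 1) : sigmaMod l pp x = 1 := by
  set S := {r : ℝ | 0 < r ∧ FiniteMod l pp (fun k => x k / r) ∧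
    sigmaMod l pp (fun k => x k / r) ≤ 1} with hS
  have hinf : sInf S = 1 := hnorm
  have hne : S.Nonempty := by
    by_contra h
    rw [Set.not_nonempty_iff_eq_empty.1 h, Real.sInf_empty] at hinf
    exact zero_ne_one hinf
  have hlb : ∀ r ∈ S, 1 ≤ r := fun r hr => hinf ▸ csInf_le ⟨0, fun _ h => h.1.le⟩ hr
  have hdil : ∀ r ∈ S, FiniteMod l pp x ∧ sigmaMod l pp x ≤ r ^ M := by
    intro r hr
    have h := finiteMod_and_sigmaMod_const_mul_le hpos hmono hM (hlb r hr) hr.2.1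
    simp only [mul_div_cancel₀ _ hr.1.ne'] at h
    exact ⟨h.1, h.2.trans (mul_le_of_le_one_right (Real.rpow_nonneg hr.1.le _) hr.2.2)⟩
  have hfin : FiniteMod l pp x := (hdil _ hne.some_mem).1
  have hcont : ContinuousAt (fun t : ℝ => t ^ M) 1 :=
    Real.continuousAt_rpow_const _ _ (Or.inl one_ne_zero)
  have htends : Tendsto (fun t : ℝ => t ^ M) (𝓝 1) (𝓝 1) := by
    simpa [ContinuousAt] using hcont
  apply le_antisymm
  · have hmem : ∃ᶠ r in 𝓝 (1 : ℝ), r ∈ S :=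
      mem_closure_iff_frequently.1 (hinf ▸ csInf_mem_closure hne ⟨0, fun _ h => h.1.le⟩)
    exact ge_of_tendsto_of_frequently htends (hmem.mono fun r hr => (hdil r hr).2)
  · by_contra! hlt
    have hmul : Tendsto (fun t : ℝ => t ^ M * sigmaMod l pp x) (𝓝[>] 1)
        (𝓝 (sigmaMod l pp x)) := by
      simpa using (htends.mono_left nhdsWithin_le_nhds).mul_const (sigmaMod l pp x)
    obtain ⟨t, hts, ht⟩ := ((hmul.eventually_lt_const hlt).and self_mem_nhdsWithin).exists
    have ht1 : 1 < t := ht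
    have h := finiteMod_and_sigmaMod_const_mul_le hpos hmono hM ht1.le hfin
    have hmem : t⁻¹ ∈ S := by
      refine ⟨by positivity, ?_⟩
      simp only [div_inv_eq_mul, mul_comm (x _) t]
      exact ⟨h.1, h.2.trans hts.le⟩
    exact (hlb _ hmem).not_gt (inv_lt_one_of_one_lt₀ ht1)

/-- If `x ∈ S(Λ_{p̂})` is an extreme point of the closed unit ball, then `σ(x) = 1`. -/
theorem extreme_point_modular_eq_one (l pp : ℕ → ℝ)
    (hpos : ∀ k, 0 < l k) (hmono : StrictMono l)
    (htop : Tendsto l atTop atTop)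
    (hratio : Tendsto (fun k => l (k + 1) / l k) atTop (𝓝 1))
    (hpp : ∀ n, 1 < pp n) (hbdd : ∃ M : ℝ, ∀ n, pp n ≤ M)
    (x : ℕ → ℝ) (hx : MemLam l pp x) (hnorm : luxNorm l pp x = 1)
    (hext : ¬ ∃ y z : ℕ → ℝ, MemLam l pp y ∧ MemLam l pp z ∧
      luxNorm l pp y ≤ 1 ∧ luxNorm l pp z ≤ 1 ∧ y ≠ z ∧
      (∀ k, 2 * x k = y k + z k)) :
    sigmaMod l pp x = 1 := by
  obtain ⟨M, hM⟩ := hbdd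
  exact sigmaMod_eq_one_of_luxNorm_eq_one hpos hmono hM hnorm
end

section
/- The von Neumann–Jordan constant of Λ_2^(2) equals 1 + λ_0/√(λ_0² + λ_1²); that is, sup{ (N(x+y)² + N(x−y)²) / (2(N(x)² + N(y)²)) : x, y ∈ ℝ², (x, y) ≠ (0, 0) } = 1 + λ_0/√(λ_0² + λ_1²). -/
/-- The norm of the two-dimensional space `Λ_2^(2)`. -/
noncomputable def N2 (l0 l1 u v : ℝ) : ℝ :=
  Real.sqrt (|u| ^ 2 + ((l0 * |u| + (l1 - l0) * |v|) / l1) ^ 2)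

/-- In rescaled coordinates the squared norm is `p² + 2t|p q| + q²` with
`t = λ₀/√(λ₀² + λ₁²)`. -/
lemma N2_sq {l0 l1 : ℝ} (h0 : 0 < l0) (h01 : l0 < l1) (u v : ℝ) :
    N2 l0 l1 u v ^ 2 =
      ((Real.sqrt (l0 ^ 2 + l1 ^ 2) * u) ^ 2 +
        2 * (l0 / Real.sqrt (l0 ^ 2 + l1 ^ 2)) *
          |(Real.sqrt (l0 ^ 2 + l1 ^ 2) * u) * ((l1 - l0) * v)| +
        ((l1 - l0) * v) ^ 2) / l1 ^ 2 := by
  have hl1 : 0 < l1 := h0.trans h01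
  have hR : 0 < Real.sqrt (l0 ^ 2 + l1 ^ 2) := by positivity
  have hR2 : Real.sqrt (l0 ^ 2 + l1 ^ 2) ^ 2 = l0 ^ 2 + l1 ^ 2 := Real.sq_sqrt (by positivity)
  rw [N2, Real.sq_sqrt (by positivity), abs_mul, abs_mul, abs_mul, abs_of_pos hR,
    abs_of_pos (sub_pos.2 h01)]
  generalize Real.sqrt (l0 ^ 2 + l1 ^ 2) = R at *
  field_simp
  rw [hR2, ← sq_abs u, ← sq_abs v]
  ring

/-- The von Neumann–Jordan inequality for the form `p² + 2t|p q| + q²`. -/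
lemma parallelogram_le {t : ℝ} (ht : 0 ≤ t) (p q r s : ℝ) :
    ((p + r) ^ 2 + 2 * t * |(p + r) * (q + s)| + (q + s) ^ 2) +
      ((p - r) ^ 2 + 2 * t * |(p - r) * (q - s)| + (q - s) ^ 2) ≤
    (1 + t) * (2 * ((p ^ 2 + 2 * t * |p * q| + q ^ 2) + (r ^ 2 + 2 * t * |r * s| + s ^ 2))) := by
  have key : |(p + r) * (q + s)| + |(p - r) * (q - s)| ≤
      p ^ 2 + q ^ 2 + r ^ 2 + s ^ 2 + 2 * |p * q| + 2 * |r * s| := by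
    have h1 := abs_nonneg (p * q)
    have h2 := abs_nonneg (r * s)
    have h3 := le_abs_self (p * q)
    have h4 := neg_abs_le (p * q)
    have h5 := le_abs_self (r * s)
    have h6 := neg_abs_le (r * s)
    rcases abs_cases ((p + r) * (q + s)) with ⟨h, -⟩ | ⟨h, -⟩ <;>
    rcases abs_cases ((p - r) * (q - s)) with ⟨h', -⟩ | ⟨h', -⟩ <;>
    rw [h, h'] <;>
    nlinarith [sq_nonneg (p - s), sq_nonneg (p + s), sq_nonneg (q - r), sq_nonneg (q + r)]
  have key' := mul_le_mul_of_nonneg_left key ht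
  have hp : 0 ≤ t * (|p * q| + |r * s|) := by positivity
  have hp' : 0 ≤ t * (t * (|p * q| + |r * s|)) := by positivity
  nlinarith

/-- The von Neumann–Jordan constant of `Λ_2^(2)` equals `1 + λ₀/√(λ₀² + λ₁²)`. -/
theorem vonNeumannJordan_Lam2 (l0 l1 : ℝ) (h0 : 0 < l0) (h01 : l0 < l1) :
    sSup {r : ℝ | ∃ a b c d : ℝ, ¬(a = 0 ∧ b = 0 ∧ c = 0 ∧ d = 0) ∧
      r = ((N2 l0 l1 (a + c) (b + d)) ^ 2 + (N2 l0 l1 (a - c) (b - d)) ^ 2) /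
        (2 * ((N2 l0 l1 a b) ^ 2 + (N2 l0 l1 c d) ^ 2))} =
    1 + l0 / Real.sqrt (l0 ^ 2 + l1 ^ 2) := by
  have hl1 : 0 < l1 := h0.trans h01
  have hm : 0 < l1 - l0 := sub_pos.2 h01
  have hR : 0 < Real.sqrt (l0 ^ 2 + l1 ^ 2) := by positivity
  simp only [N2_sq h0 h01]
  generalize Real.sqrt (l0 ^ 2 + l1 ^ 2) = R at *
  have ht : 0 < l0 / R := div_pos h0 hR
  generalize l0 / R = t at *
  refine IsGreatest.csSup_eq ⟨⟨l1 - l0, 0, 0, R, ?_, ?_⟩, ?_⟩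
  · exact fun h => hm.ne' h.1
  · have hP : |R * (l1 - l0) * ((l1 - l0) * R)| = (R * (l1 - l0)) ^ 2 := by
      rw [abs_of_pos (by positivity)]; ring
    have hM : |R * (l1 - l0) * ((l1 - l0) * -R)| = (R * (l1 - l0)) ^ 2 := by
      rw [mul_neg, mul_neg, abs_neg, hP]
    simp only [add_zero, zero_add, sub_zero, zero_sub, hP, hM, mul_zero, zero_mul, abs_zero]
    field_simp
    ring
  · rintro _ ⟨a, b, c, d, hne, rfl⟩
    refine div_le_of_le_mul₀ (by positivity) (by positivity) ?_
    have h := div_le_div_of_nonneg_right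
      (parallelogram_le ht.le (R * a) ((l1 - l0) * b) (R * c) ((l1 - l0) * d)) (sq_nonneg l1)
    simp only [← mul_add, ← mul_sub] at h
    convert h using 1 <;> ring
end

section
/- For all (a, b), (c, d) ∈ ℝ²: N(a+c, b+d)² + N(a−c, b−d)² ≤ 2 (1 + λ_0/√(λ_0² + λ_1²)) (N(a, b)² + N(c, d)²). -/
/-- `N2 ^ 2` exceeds the quadratic form `((l0² + l1²) u² + (l1 - l0)² v²) / l1²` by a
nonnegative cross term. -/
lemma N2_sq_eq {l0 l1 : ℝ} (h1 : 0 < l1) (u v : ℝ) :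
    N2 l0 l1 u v ^ 2 = ((l0 ^ 2 + l1 ^ 2) * u ^ 2 + (l1 - l0) ^ 2 * v ^ 2) / l1 ^ 2 +
      2 * l0 * (l1 - l0) * (|u| * |v|) / l1 ^ 2 := by
  rw [N2, Real.sq_sqrt (by positivity), ← sq_abs u, ← sq_abs v]
  field_simp
  ring

lemma le_N2_sq {l0 l1 : ℝ} (h0 : 0 < l0) (h01 : l0 < l1) (u v : ℝ) :
    ((l0 ^ 2 + l1 ^ 2) * u ^ 2 + (l1 - l0) ^ 2 * v ^ 2) / l1 ^ 2 ≤ N2 l0 l1 u v ^ 2 := by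
  rw [N2_sq_eq (h0.trans h01)]
  have := sub_pos.2 h01
  exact le_add_of_nonneg_right (by positivity)

lemma N2_sq_le {l0 l1 : ℝ} (h0 : 0 < l0) (h01 : l0 < l1) (u v : ℝ) :
    N2 l0 l1 u v ^ 2 ≤ (1 + l0 / Real.sqrt (l0 ^ 2 + l1 ^ 2)) *
      (((l0 ^ 2 + l1 ^ 2) * u ^ 2 + (l1 - l0) ^ 2 * v ^ 2) / l1 ^ 2) := by
  rw [N2_sq_eq (h0.trans h01), one_add_mul, ← mul_div_assoc]
  have hs : 0 < Real.sqrt (l0 ^ 2 + l1 ^ 2) := by positivity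
  have hs2 : Real.sqrt (l0 ^ 2 + l1 ^ 2) ^ 2 = l0 ^ 2 + l1 ^ 2 := Real.sq_sqrt (by positivity)
  rw [← hs2, Real.sqrt_sq hs.le]
  generalize Real.sqrt (l0 ^ 2 + l1 ^ 2) = s at hs
  gcongr _ + ?_ / _
  rw [div_mul_eq_mul_div, le_div_iff₀ hs]
  have key : 2 * (s * |u|) * ((l1 - l0) * |v|) ≤ (s * |u|) ^ 2 + ((l1 - l0) * |v|) ^ 2 :=
    two_mul_le_add_sq _ _
  rw [mul_pow, mul_pow, sq_abs, sq_abs] at key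
  linarith [mul_le_mul_of_nonneg_left key h0.le]

/-- The parallelogram-type inequality for `Λ_2^(2)`. -/
theorem Lam2_parallelogram_ineq (l0 l1 : ℝ) (h0 : 0 < l0) (h01 : l0 < l1)
    (a b c d : ℝ) :
    (N2 l0 l1 (a + c) (b + d)) ^ 2 + (N2 l0 l1 (a - c) (b - d)) ^ 2 ≤
      2 * (1 + l0 / Real.sqrt (l0 ^ 2 + l1 ^ 2)) *
        ((N2 l0 l1 a b) ^ 2 + (N2 l0 l1 c d) ^ 2) := by
  have hT : 0 ≤ 1 + l0 / Real.sqrt (l0 ^ 2 + l1 ^ 2) := by positivity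
  have hab := mul_le_mul_of_nonneg_left
    (add_le_add (le_N2_sq h0 h01 a b) (le_N2_sq h0 h01 c d)) hT
  refine (add_le_add (N2_sq_le h0 h01 (a + c) (b + d)) (N2_sq_le h0 h01 (a - c) (b - d))).trans ?_
  rw [mul_assoc 2]
  refine le_trans (le_of_eq ?_) (mul_le_mul_of_nonneg_left hab zero_le_two)
  ring
end

section
/- The James constant of Λ_2^(2) equals √(2 + 2λ_0/√(λ_0² + λ_1²)); that is, sup{ min(N(x+y), N(x−y)) : x, y ∈ ℝ², N(x) = N(y) = 1 } = √(2 + 2λ_0/√(λ_0² + λ_1²)). -/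
/-- The quadratic form whose square root is the norm `N2` in rescaled coordinates. -/
def absForm (k s w : ℝ) : ℝ := s ^ 2 + w ^ 2 + 2 * k * |s * w|

theorem N2_eq_sqrt_absForm {l0 l1 : ℝ} (h0 : 0 < l0) (h01 : l0 < l1) (u v : ℝ) :
    N2 l0 l1 u v = Real.sqrt (absForm (l0 / Real.sqrt (l0 ^ 2 + l1 ^ 2))
      (Real.sqrt (l0 ^ 2 + l1 ^ 2) / l1 * u) ((l1 - l0) / l1 * v)) := by
  have h1 : 0 < l1 := h0.trans h01
  have hR : 0 < Real.sqrt (l0 ^ 2 + l1 ^ 2) := by positivity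
  have hR2 : Real.sqrt (l0 ^ 2 + l1 ^ 2) ^ 2 = l0 ^ 2 + l1 ^ 2 := Real.sq_sqrt (by positivity)
  have hd : 0 < l1 - l0 := sub_pos.2 h01
  unfold N2 absForm
  congr 1
  rw [abs_mul, abs_mul, abs_mul, abs_of_pos (div_pos hR h1), abs_of_pos (div_pos hd h1),
    mul_pow, mul_pow, div_pow (Real.sqrt _), hR2, ← sq_abs u, ← sq_abs v]
  field_simp
  ring

theorem abs_mul_add_abs_mul_le (a b c d : ℝ) :
    |(a + c) * (b + d)| + |(a - c) * (b - d)| ≤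
      2 * |a * b| + 2 * |c * d| + (a ^ 2 + b ^ 2 + c ^ 2 + d ^ 2) := by
  have h1 := sq_nonneg (a + d)
  have h2 := sq_nonneg (a - d)
  have h3 := sq_nonneg (b + c)
  have h4 := sq_nonneg (b - c)
  have h5 := le_abs_self (a * b)
  have h6 := neg_abs_le (a * b)
  have h7 := le_abs_self (c * d)
  have h8 := neg_abs_le (c * d)
  have h9 : 0 ≤ a ^ 2 + b ^ 2 + c ^ 2 + d ^ 2 := by positivity
  rcases abs_cases ((a + c) * (b + d)) with ⟨h, -⟩ | ⟨h, -⟩ <;>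
  rcases abs_cases ((a - c) * (b - d)) with ⟨h', -⟩ | ⟨h', -⟩ <;>
  rw [h, h'] <;> nlinarith

theorem min_absForm_le {k a b c d : ℝ} (hk : 0 ≤ k) (hx : absForm k a b = 1)
    (hy : absForm k c d = 1) :
    min (absForm k (a + c) (b + d)) (absForm k (a - c) (b - d)) ≤ 2 + 2 * k := by
  unfold absForm at *
  have h := mul_le_mul_of_nonneg_left (abs_mul_add_abs_mul_le a b c d) hk
  have hs : k * (a ^ 2 + b ^ 2 + c ^ 2 + d ^ 2) ≤ k * 2 := by
    apply mul_le_mul_of_nonneg_left _ hk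
    have := mul_nonneg hk (abs_nonneg (a * b))
    have := mul_nonneg hk (abs_nonneg (c * d))
    linarith
  rw [min_le_iff]
  by_contra! hc
  nlinarith [hc.1, hc.2]

/-- The James constant of `Λ_2^(2)` equals `√(2 + 2λ₀/√(λ₀² + λ₁²))`. -/
theorem james_constant_Lam2 (l0 l1 : ℝ) (h0 : 0 < l0) (h01 : l0 < l1) :
    sSup {r : ℝ | ∃ a b c d : ℝ, N2 l0 l1 a b = 1 ∧ N2 l0 l1 c d = 1 ∧
      r = min (N2 l0 l1 (a + c) (b + d)) (N2 l0 l1 (a - c) (b - d))} =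
    Real.sqrt (2 + 2 * l0 / Real.sqrt (l0 ^ 2 + l1 ^ 2)) := by
  have h1 : 0 < l1 := h0.trans h01
  have hd : 0 < l1 - l0 := sub_pos.2 h01
  have hR : 0 < Real.sqrt (l0 ^ 2 + l1 ^ 2) := by positivity
  simp only [N2_eq_sqrt_absForm h0 h01, Real.sqrt_eq_one, mul_add, mul_sub]
  rw [mul_div_assoc]
  set R := Real.sqrt (l0 ^ 2 + l1 ^ 2)
  have hk : 0 ≤ l0 / R := by positivity
  apply IsGreatest.csSup_eq
  constructor
  · have hP : R / l1 * (l1 / R) = 1 := by field_simp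
    have hQ : (l1 - l0) / l1 * (l1 / (l1 - l0)) = 1 := by field_simp
    refine ⟨l1 / R, 0, 0, l1 / (l1 - l0), ?_, ?_, ?_⟩ <;> simp only [hP, hQ] <;> norm_num [absForm]
  · rintro r ⟨a, b, c, d, hx, hy, rfl⟩
    rw [← Real.sqrt_monotone.map_min]
    exact Real.sqrt_le_sqrt (min_absForm_le hk hx hy)
end

section
/- Let q_0, q_1 > 0 and set λ_0 = q_0, λ_1 = q_0 + q_1. Then the von Neumann–Jordan constant of the two-dimensional space with norm N(u,v) = (|u|² + ((q_0|u| + q_1|v|)/(q_0+q_1))²)^{1/2} equals 1 + q_0/√(2q_0² + 2q_0q_1 + q_1²), and its James constant equals √(2 + 2q_0/√(2q_0² + 2q_0q_1 + q_1²)). -/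
/-- The norm of the two-dimensional space `ces[2, q]^(2)`. -/
noncomputable def Nq (q0 q1 u v : ℝ) : ℝ :=
  Real.sqrt (|u| ^ 2 + ((q0 * |u| + q1 * |v|) / (q0 + q1)) ^ 2)

lemma abs_add_mul_abs_add_add_abs_sub_mul_abs_sub_le (a b c d : ℝ) :
    |a + c| * |b + d| + |a - c| * |b - d| ≤ a ^ 2 + b ^ 2 + c ^ 2 + d ^ 2 := by
  have h₁ := two_mul_le_add_sq |a + c| |b + d|
  have h₂ := two_mul_le_add_sq |a - c| |b - d|
  simp only [sq_abs] at h₁ h₂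
  linarith

lemma Nq_nonneg (q0 q1 u v : ℝ) : 0 ≤ Nq q0 q1 u v := Real.sqrt_nonneg _

/-- In the coordinates `D * u`, `q1 * v`, the squared norm is a multiple of
`U ^ 2 + V ^ 2 + 2 * k * |U| * |V|` with `k = q0 / D`. -/
lemma Nq_sq {q0 q1 D : ℝ} (hq0 : 0 < q0) (hq1 : 0 < q1) (hD : 0 < D)
    (hD2 : D ^ 2 = 2 * q0 ^ 2 + 2 * q0 * q1 + q1 ^ 2) (u v : ℝ) :
    Nq q0 q1 u v ^ 2 =
      ((D * u) ^ 2 + (q1 * v) ^ 2 + 2 * (q0 / D) * (|D * u| * |q1 * v|)) / (q0 + q1) ^ 2 := by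
  have hs : q0 + q1 ≠ 0 := by positivity
  rw [Nq, Real.sq_sqrt (by positivity), abs_mul, abs_mul, abs_of_pos hD, abs_of_pos hq1,
    mul_pow, mul_pow, hD2, ← sq_abs u, ← sq_abs v]
  field_simp
  ring

lemma Nq_sq_add_Nq_sq_le {q0 q1 D : ℝ} (hq0 : 0 < q0) (hq1 : 0 < q1) (hD : 0 < D)
    (hD2 : D ^ 2 = 2 * q0 ^ 2 + 2 * q0 * q1 + q1 ^ 2) (a b c d : ℝ) :
    Nq q0 q1 (a + c) (b + d) ^ 2 + Nq q0 q1 (a - c) (b - d) ^ 2 ≤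
      (1 + q0 / D) * (2 * (Nq q0 q1 a b ^ 2 + Nq q0 q1 c d ^ 2)) := by
  simp only [Nq_sq hq0 hq1 hD hD2, mul_add D, mul_sub D, mul_add q1, mul_sub q1, ← add_div]
  have hk : 0 < q0 / D := by positivity
  generalize q0 / D = k at *
  rw [← mul_div_assoc 2, ← mul_div_assoc (1 + k)]
  generalize D * a = a, q1 * b = b, D * c = c, q1 * d = d
  have h := mul_le_mul_of_nonneg_left
    (abs_add_mul_abs_add_add_abs_sub_mul_abs_sub_le a b c d) hk.le
  have h₁ : 0 ≤ k * (|a| * |b|) := by positivity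
  have h₂ : 0 ≤ k * (|c| * |d|) := by positivity
  have h₃ : 0 ≤ k * (k * (|a| * |b|)) := by positivity
  have h₄ : 0 ≤ k * (k * (|c| * |d|)) := by positivity
  gcongr
  linarith

lemma Nq_sq_pos {q0 q1 : ℝ} (hq0 : 0 < q0) (hq1 : 0 < q1) {u v : ℝ} (h : ¬(u = 0 ∧ v = 0)) :
    0 < Nq q0 q1 u v ^ 2 := by
  rw [Nq, Real.sq_sqrt (by positivity)]
  by_cases hu : u = 0
  · have hv : 0 < |v| := abs_pos.2 fun hv => h ⟨hu, hv⟩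
    positivity
  · have hu : 0 < |u| := abs_pos.2 hu
    positivity

/-- For `ces[2, q]^(2)` the von Neumann–Jordan constant equals
`1 + q₀/√(2q₀² + 2q₀q₁ + q₁²)` and the James constant equals
`√(2 + 2q₀/√(2q₀² + 2q₀q₁ + q₁²))`. -/
theorem cesq_constants (q0 q1 : ℝ) (hq0 : 0 < q0) (hq1 : 0 < q1) :
    sSup {r : ℝ | ∃ a b c d : ℝ, ¬(a = 0 ∧ b = 0 ∧ c = 0 ∧ d = 0) ∧
      r = ((Nq q0 q1 (a + c) (b + d)) ^ 2 + (Nq q0 q1 (a - c) (b - d)) ^ 2) /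
        (2 * ((Nq q0 q1 a b) ^ 2 + (Nq q0 q1 c d) ^ 2))} =
      1 + q0 / Real.sqrt (2 * q0 ^ 2 + 2 * q0 * q1 + q1 ^ 2) ∧
    sSup {r : ℝ | ∃ a b c d : ℝ, Nq q0 q1 a b = 1 ∧ Nq q0 q1 c d = 1 ∧
      r = min (Nq q0 q1 (a + c) (b + d)) (Nq q0 q1 (a - c) (b - d))} =
      Real.sqrt (2 + 2 * q0 / Real.sqrt (2 * q0 ^ 2 + 2 * q0 * q1 + q1 ^ 2)) := by
  have hD : 0 < √(2 * q0 ^ 2 + 2 * q0 * q1 + q1 ^ 2) := Real.sqrt_pos.2 (by positivity)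
  have hD2 : √(2 * q0 ^ 2 + 2 * q0 * q1 + q1 ^ 2) ^ 2 = 2 * q0 ^ 2 + 2 * q0 * q1 + q1 ^ 2 :=
    Real.sq_sqrt (by positivity)
  generalize √(2 * q0 ^ 2 + 2 * q0 * q1 + q1 ^ 2) = D at *
  have hs : 0 < q0 + q1 := by positivity
  have hx : Nq q0 q1 ((q0 + q1) / D) 0 ^ 2 = 1 := by
    rw [Nq_sq hq0 hq1 hD hD2, mul_div_cancel₀ _ hD.ne']
    simp [hs.ne']
  have hy : Nq q0 q1 0 ((q0 + q1) / q1) ^ 2 = 1 := by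
    rw [Nq_sq hq0 hq1 hD hD2, mul_div_cancel₀ _ hq1.ne']
    simp [hs.ne']
  have hadd : Nq q0 q1 ((q0 + q1) / D + 0) (0 + (q0 + q1) / q1) ^ 2 = 2 + 2 * q0 / D := by
    rw [Nq_sq hq0 hq1 hD hD2, add_zero, zero_add, mul_div_cancel₀ _ hD.ne',
      mul_div_cancel₀ _ hq1.ne', abs_of_pos hs]
    field_simp
    ring
  have hsub : Nq q0 q1 ((q0 + q1) / D - 0) (0 - (q0 + q1) / q1) ^ 2 = 2 + 2 * q0 / D := by
    rw [← hadd]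
    simp [Nq]
  constructor
  · refine IsGreatest.csSup_eq ⟨⟨(q0 + q1) / D, 0, 0, (q0 + q1) / q1, ?_, ?_⟩, ?_⟩
    · exact fun h => (div_pos hs hD).ne' h.1
    · rw [hadd, hsub, hx, hy]
      ring
    · rintro r ⟨a, b, c, d, h, rfl⟩
      have hpos : 0 < Nq q0 q1 a b ^ 2 + Nq q0 q1 c d ^ 2 := by
        by_cases hab : a = 0 ∧ b = 0
        · have hcd : ¬(c = 0 ∧ d = 0) := fun hcd => h ⟨hab.1, hab.2, hcd⟩
          exact add_pos_of_nonneg_of_pos (sq_nonneg _) (Nq_sq_pos hq0 hq1 hcd)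
        · exact add_pos_of_pos_of_nonneg (Nq_sq_pos hq0 hq1 hab) (sq_nonneg _)
      rw [div_le_iff₀ (by positivity)]
      exact Nq_sq_add_Nq_sq_le hq0 hq1 hD hD2 a b c d
  · refine IsGreatest.csSup_eq ⟨⟨(q0 + q1) / D, 0, 0, (q0 + q1) / q1, ?_, ?_, ?_⟩, ?_⟩
    · exact (pow_eq_one_iff_of_nonneg (Nq_nonneg _ _ _ _) two_ne_zero).1 hx
    · exact (pow_eq_one_iff_of_nonneg (Nq_nonneg _ _ _ _) two_ne_zero).1 hy
    · rw [← Real.sqrt_sq (Nq_nonneg q0 q1 (_ + _) _), ← Real.sqrt_sq (Nq_nonneg q0 q1 (_ - _) _),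
        hadd, hsub, min_self]
    · rintro r ⟨a, b, c, d, hab, hcd, rfl⟩
      have h := Nq_sq_add_Nq_sq_le hq0 hq1 hD hD2 a b c d
      rw [hab, hcd] at h
      have hmin := le_min (Nq_nonneg q0 q1 (a + c) (b + d)) (Nq_nonneg q0 q1 (a - c) (b - d))
      have h₁ := pow_le_pow_left₀ hmin (min_le_left _ _) 2
      have h₂ := pow_le_pow_left₀ hmin (min_le_right _ _) 2
      refine Real.le_sqrt_of_sq_le ?_
      rw [mul_div_assoc]
      linarith
end

section
/- Let 1 < p ≤ 2. The von Neumann–Jordan constant of Λ_p^(2) equals (sup_{0 ≤ t ≤ 1} ψ(t)/ψ₂(t))², where ψ(t) = ( λ_1^p (1−t)^p/(λ_0^p + λ_1^p) + ( λ_0(1−t)/(λ_0^p + λ_1^p)^{1/p} + t )^p )^{1/p} and ψ₂(t) = √((1−t)² + t²). That is, sup{ (N_p(x+y)² + N_p(x−y)²)/(2(N_p(x)² + N_p(y)²)) : x, y ∈ ℝ², (x,y) ≠ (0,0) } = (sup_{0 ≤ t ≤ 1} ψ(t)/ψ₂(t))². -/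
/-- The norm of the two-dimensional space `Λ_p^(2)`. -/
noncomputable def NpLam (l0 l1 p u v : ℝ) : ℝ :=
  (|u| ^ p + ((l0 * |u| + (l1 - l0) * |v|) / l1) ^ p) ^ (1 / p)

/-- `ψ(t)` from the paper. -/
noncomputable def psiLam (l0 l1 p t : ℝ) : ℝ :=
  (l1 ^ p * (1 - t) ^ p / (l0 ^ p + l1 ^ p) +
    (l0 * (1 - t) / (l0 ^ p + l1 ^ p) ^ (1 / p) + t) ^ p) ^ (1 / p)

/-- `ψ₂(t) = √((1−t)² + t²)`. -/
noncomputable def psiTwo (t : ℝ) : ℝ := Real.sqrt ((1 - t) ^ 2 + t ^ 2)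

/-- The absolute normalized norm on `ℝ²` whose restriction to the segment `(1 - t, t)` is
`psiLam`, on the first quadrant. -/
noncomputable def quadrantNormLam (l0 l1 p s w : ℝ) : ℝ :=
  (l1 ^ p * s ^ p / (l0 ^ p + l1 ^ p) +
    (l0 * s / (l0 ^ p + l1 ^ p) ^ (1 / p) + w) ^ p) ^ (1 / p)

theorem add_rpow_le_rpow_add_real {p a b : ℝ} (ha : 0 ≤ a) (hb : 0 ≤ b) (hp : 1 ≤ p) :
    a ^ p + b ^ p ≤ (a + b) ^ p := by
  lift a to NNReal using ha
  lift b to NNReal using hb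
  exact_mod_cast NNReal.add_rpow_le_rpow_add a b hp

theorem sqrt_sq_add_sq_le_rpow {p a b : ℝ} (ha : 0 ≤ a) (hb : 0 ≤ b) (hp0 : 0 < p)
    (hp : p ≤ 2) : √(a ^ 2 + b ^ 2) ≤ (a ^ p + b ^ p) ^ (1 / p) := by
  lift a to NNReal using ha
  lift b to NNReal using hb
  have h := NNReal.rpow_add_rpow_le a b hp0 hp
  rw [Real.sqrt_eq_rpow]
  exact_mod_cast h

section

variable {l0 l1 p : ℝ}

theorem rpow_one_div_rpow_self {a p : ℝ} (ha : 0 ≤ a) (hp : p ≠ 0) : (a ^ (1 / p)) ^ p = a := by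
  rw [← Real.rpow_mul ha, one_div_mul_cancel hp, Real.rpow_one]

theorem quadrantNormLam_nonneg (h0 : 0 < l0) (h1 : 0 < l1) {s w : ℝ} (hs : 0 ≤ s)
    (hw : 0 ≤ w) : 0 ≤ quadrantNormLam l0 l1 p s w := by
  unfold quadrantNormLam
  positivity

theorem quadrantNormLam_mul (h0 : 0 < l0) (h1 : 0 < l1) (hp : 0 < p) {c s w : ℝ}
    (hc : 0 ≤ c) (hs : 0 ≤ s) (hw : 0 ≤ w) :
    quadrantNormLam l0 l1 p (c * s) (c * w) = c * quadrantNormLam l0 l1 p s w := by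
  unfold quadrantNormLam
  have h : l0 * (c * s) / (l0 ^ p + l1 ^ p) ^ (1 / p) + c * w =
      c * (l0 * s / (l0 ^ p + l1 ^ p) ^ (1 / p) + w) := by ring
  rw [h, Real.mul_rpow hc hs, Real.mul_rpow hc (by positivity),
    show l1 ^ p * (c ^ p * s ^ p) / (l0 ^ p + l1 ^ p) +
      c ^ p * (l0 * s / (l0 ^ p + l1 ^ p) ^ (1 / p) + w) ^ p =
      c ^ p * (l1 ^ p * s ^ p / (l0 ^ p + l1 ^ p) +
      (l0 * s / (l0 ^ p + l1 ^ p) ^ (1 / p) + w) ^ p) by ring,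
    Real.mul_rpow (by positivity) (by positivity), ← Real.rpow_mul hc,
    mul_one_div_cancel hp.ne', Real.rpow_one]

theorem sqrt_sq_add_sq_le_quadrantNormLam (h0 : 0 < l0) (h1 : 0 < l1) (hp1 : 1 ≤ p)
    (hp2 : p ≤ 2) {s w : ℝ} (hs : 0 ≤ s) (hw : 0 ≤ w) :
    √(s ^ 2 + w ^ 2) ≤ quadrantNormLam l0 l1 p s w := by
  have hp : 0 < p := by linarith
  refine (sqrt_sq_add_sq_le_rpow hs hw hp hp2).trans ?_
  unfold quadrantNormLam
  have hK : 0 < l0 ^ p + l1 ^ p := by positivity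
  refine Real.rpow_le_rpow (by positivity) ?_ (by positivity)
  have h := add_rpow_le_rpow_add_real (a := l0 * s / (l0 ^ p + l1 ^ p) ^ (1 / p)) (b := w)
    (by positivity) hw hp1
  rw [Real.div_rpow (by positivity) (by positivity), rpow_one_div_rpow_self hK.le hp.ne',
    Real.mul_rpow h0.le hs] at h
  have hs' : s ^ p = l1 ^ p * s ^ p / (l0 ^ p + l1 ^ p) + l0 ^ p * s ^ p / (l0 ^ p + l1 ^ p) := by
    field_simp
    ring
  linarith

theorem psiLam_eq_quadrantNormLam (t : ℝ) :
    psiLam l0 l1 p t = quadrantNormLam l0 l1 p (1 - t) t := rfl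

theorem NpLam_eq_quadrantNormLam (h0 : 0 < l0) (h1 : 0 < l1) (hp : 0 < p) (u v : ℝ) :
    NpLam l0 l1 p u v = quadrantNormLam l0 l1 p
      ((l0 ^ p + l1 ^ p) ^ (1 / p) / l1 * |u|) ((l1 - l0) / l1 * |v|) := by
  have hK : 0 < l0 ^ p + l1 ^ p := by positivity
  unfold NpLam quadrantNormLam
  rw [Real.mul_rpow (by positivity) (abs_nonneg u),
    Real.div_rpow (x := (l0 ^ p + l1 ^ p) ^ (1 / p)) (by positivity) h1.le,
    rpow_one_div_rpow_self hK.le hp.ne']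
  have hK' : 0 < (l0 ^ p + l1 ^ p) ^ (1 / p) := by positivity
  have hl : 0 < l1 ^ p := by positivity
  congr 2
  · field_simp
  · congr 1
    field_simp

theorem psiTwo_pos (t : ℝ) : 0 < psiTwo t :=
  Real.sqrt_pos.2 (by nlinarith [sq_nonneg (1 - 2 * t)])

theorem bddAbove_psiLam_div_psiTwo (hp : 0 < p) :
    BddAbove ((fun t => psiLam l0 l1 p t / psiTwo t) '' Set.Icc (0 : ℝ) 1) := by
  refine (isCompact_Icc.image_of_continuousOn ?_).bddAbove
  refine ContinuousOn.div ?_ ?_ fun t _ => (psiTwo_pos t).ne'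
  · unfold psiLam
    have hp' : 0 ≤ 1 / p := by positivity
    refine ContinuousOn.rpow_const (ContinuousOn.add (ContinuousOn.div_const
      (ContinuousOn.mul continuousOn_const (ContinuousOn.rpow_const (by fun_prop) ?_)) _)
      (ContinuousOn.rpow_const (by fun_prop) ?_)) ?_
    · exact fun _ _ => Or.inr hp.le
    · exact fun _ _ => Or.inr hp.le
    · exact fun _ _ => Or.inr hp'
  · unfold psiTwo
    fun_prop

theorem quadrantNormLam_le_sSup_mul (h0 : 0 < l0) (h1 : 0 < l1) (hp : 0 < p) {s w : ℝ}
    (hs : 0 ≤ s) (hw : 0 ≤ w) :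
    quadrantNormLam l0 l1 p s w ≤
      sSup ((fun t => psiLam l0 l1 p t / psiTwo t) '' Set.Icc (0 : ℝ) 1) *
        √(s ^ 2 + w ^ 2) := by
  rcases (add_nonneg hs hw).eq_or_lt with h | h
  · obtain rfl : s = 0 := by linarith
    obtain rfl : w = 0 := by linarith
    simpa using (quadrantNormLam_mul h0 h1 hp le_rfl le_rfl le_rfl : quadrantNormLam l0 l1 p
      (0 * 0) (0 * 0) = 0 * quadrantNormLam l0 l1 p 0 0).le
  · set t := w / (s + w) with ht
    have hs' : s = (s + w) * (1 - t) := by rw [ht]; field_simp; ring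
    have hw' : w = (s + w) * t := by rw [ht]; field_simp
    have ht1 : t ≤ 1 := by rw [ht, div_le_one h]; linarith
    have ht0 : 0 ≤ t := by positivity
    have hle := le_csSup (bddAbove_psiLam_div_psiTwo hp)
      (Set.mem_image_of_mem (fun t => psiLam l0 l1 p t / psiTwo t) ⟨ht0, ht1⟩)
    rw [div_le_iff₀ (psiTwo_pos t), psiLam_eq_quadrantNormLam] at hle
    have hsq : √(s ^ 2 + w ^ 2) = (s + w) * psiTwo t := by
      rw [psiTwo, ← Real.sqrt_sq h.le, ← Real.sqrt_mul (sq_nonneg _)]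
      congr 1
      nth_rewrite 1 [hs']
      nth_rewrite 2 [hw']
      ring
    have hL : quadrantNormLam l0 l1 p s w = (s + w) * quadrantNormLam l0 l1 p (1 - t) t := by
      rw [← quadrantNormLam_mul h0 h1 hp h.le (by linarith) ht0, ← hs', ← hw']
    rw [hL, hsq, mul_left_comm]
    exact mul_le_mul_of_nonneg_left hle h.le

theorem quadrantNormLam_zero_right (h0 : 0 < l0) (h1 : 0 < l1) (hp : 0 < p) {s : ℝ}
    (hs : 0 ≤ s) : quadrantNormLam l0 l1 p s 0 = s := by
  have hK : 0 < l0 ^ p + l1 ^ p := by positivity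
  unfold quadrantNormLam
  rw [add_zero, Real.div_rpow (by positivity) (by positivity),
    rpow_one_div_rpow_self hK.le hp.ne', Real.mul_rpow h0.le hs,
    show l1 ^ p * s ^ p / (l0 ^ p + l1 ^ p) + l0 ^ p * s ^ p / (l0 ^ p + l1 ^ p) = s ^ p by
      field_simp; ring,
    ← Real.rpow_mul hs, mul_one_div_cancel hp.ne', Real.rpow_one]

theorem quadrantNormLam_zero_left (hp : 0 < p) {w : ℝ} (hw : 0 ≤ w) :
    quadrantNormLam l0 l1 p 0 w = w := by
  unfold quadrantNormLam
  rw [Real.zero_rpow hp.ne', mul_zero, mul_zero, zero_div, zero_div, zero_add, zero_add,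
    ← Real.rpow_mul hw, mul_one_div_cancel hp.ne', Real.rpow_one]

theorem vonNeumannJordan_quotient_le (h0 : 0 < l0) (h01 : l0 < l1) (hp1 : 1 < p) (hp2 : p ≤ 2)
    (a b c d : ℝ) :
    ((NpLam l0 l1 p (a + c) (b + d)) ^ 2 + (NpLam l0 l1 p (a - c) (b - d)) ^ 2) /
        (2 * ((NpLam l0 l1 p a b) ^ 2 + (NpLam l0 l1 p c d) ^ 2)) ≤
    (sSup ((fun t => psiLam l0 l1 p t / psiTwo t) '' Set.Icc (0 : ℝ) 1)) ^ 2 := by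
  set M := sSup ((fun t => psiLam l0 l1 p t / psiTwo t) '' Set.Icc (0 : ℝ) 1)
  have h1 : 0 < l1 := h0.trans h01
  have hp : 0 < p := by linarith
  have hl : 0 < l1 - l0 := sub_pos.2 h01
  set k := (l0 ^ p + l1 ^ p) ^ (1 / p) / l1
  set m := (l1 - l0) / l1
  have hk : 0 ≤ k := by positivity
  have hm : 0 ≤ m := by positivity
  have upper (u v : ℝ) :
      NpLam l0 l1 p u v ^ 2 ≤ M ^ 2 * ((k * u) ^ 2 + (m * v) ^ 2) := by
    have hu : 0 ≤ k * |u| := by positivity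
    have hv : 0 ≤ m * |v| := by positivity
    rw [NpLam_eq_quadrantNormLam h0 h1 hp]
    refine (pow_le_pow_left₀ (quadrantNormLam_nonneg h0 h1 hu hv)
      (quadrantNormLam_le_sSup_mul h0 h1 hp hu hv) 2).trans_eq ?_
    rw [mul_pow, Real.sq_sqrt (by positivity)]
    simp only [mul_pow, sq_abs, M]
  have lower (u v : ℝ) : (k * u) ^ 2 + (m * v) ^ 2 ≤ NpLam l0 l1 p u v ^ 2 := by
    have hu : 0 ≤ k * |u| := by positivity
    have hv : 0 ≤ m * |v| := by positivity
    rw [NpLam_eq_quadrantNormLam h0 h1 hp]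
    have h := (Real.sqrt_le_left (quadrantNormLam_nonneg h0 h1 hu hv)).1
      (sqrt_sq_add_sq_le_quadrantNormLam h0 h1 hp1.le hp2 hu hv)
    simpa only [mul_pow, sq_abs] using h
  refine div_le_of_le_mul₀ (by positivity) (sq_nonneg M) ?_
  calc _ ≤ M ^ 2 * ((k * (a + c)) ^ 2 + (m * (b + d)) ^ 2) +
        M ^ 2 * ((k * (a - c)) ^ 2 + (m * (b - d)) ^ 2) := add_le_add (upper _ _) (upper _ _)
    _ = M ^ 2 * (2 * (((k * a) ^ 2 + (m * b) ^ 2) + ((k * c) ^ 2 + (m * d) ^ 2))) := by ring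
    _ ≤ _ := by gcongr <;> exact lower _ _

theorem sq_psiLam_div_psiTwo_eq_quotient (h0 : 0 < l0) (h01 : l0 < l1) (hp : 0 < p) {t : ℝ}
    (ht : t ∈ Set.Icc (0 : ℝ) 1) :
    ∃ a b c d : ℝ, ¬(a = 0 ∧ b = 0 ∧ c = 0 ∧ d = 0) ∧
      (psiLam l0 l1 p t / psiTwo t) ^ 2 =
        ((NpLam l0 l1 p (a + c) (b + d)) ^ 2 + (NpLam l0 l1 p (a - c) (b - d)) ^ 2) /
          (2 * ((NpLam l0 l1 p a b) ^ 2 + (NpLam l0 l1 p c d) ^ 2)) := by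
  have h1 : 0 < l1 := h0.trans h01
  have hl : 0 < l1 - l0 := sub_pos.2 h01
  have ht1 : 0 ≤ 1 - t := sub_nonneg.2 ht.2
  have hK : 0 < (l0 ^ p + l1 ^ p) ^ (1 / p) / l1 := by positivity
  have hm : 0 < (l1 - l0) / l1 := by positivity
  simp only [NpLam_eq_quadrantNormLam h0 h1 hp]
  generalize (l0 ^ p + l1 ^ p) ^ (1 / p) / l1 = k at hK
  generalize (l1 - l0) / l1 = m at hm
  refine ⟨(1 - t) / k, 0, 0, t / m, ?_, ?_⟩
  · rintro ⟨h, -, -, h'⟩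
    rw [div_eq_zero_iff] at h h'
    grind
  · have e1 : k * |(1 - t) / k| = 1 - t := by
      rw [abs_of_nonneg (by positivity), mul_div_cancel₀ _ hK.ne']
    have e2 : m * |t / m| = t := by
      rw [abs_of_nonneg (div_nonneg ht.1 hm.le), mul_div_cancel₀ _ hm.ne']
    simp only [add_zero, zero_add, sub_zero, zero_sub, abs_neg, abs_zero, mul_zero, e1, e2]
    rw [quadrantNormLam_zero_right h0 h1 hp ht1, quadrantNormLam_zero_left hp ht.1,
      psiLam_eq_quadrantNormLam, div_pow, psiTwo, Real.sq_sqrt (by positivity), ← two_mul,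
      mul_div_mul_left _ _ two_ne_zero]

end

/-- The von Neumann–Jordan constant of `Λ_p^(2)` for `1 < p ≤ 2`. -/
theorem vonNeumannJordan_LamP2 (l0 l1 p : ℝ) (h0 : 0 < l0) (h01 : l0 < l1)
    (hp1 : 1 < p) (hp2 : p ≤ 2) :
    sSup {r : ℝ | ∃ a b c d : ℝ, ¬(a = 0 ∧ b = 0 ∧ c = 0 ∧ d = 0) ∧
      r = ((NpLam l0 l1 p (a + c) (b + d)) ^ 2 + (NpLam l0 l1 p (a - c) (b - d)) ^ 2) /
        (2 * ((NpLam l0 l1 p a b) ^ 2 + (NpLam l0 l1 p c d) ^ 2))} =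
    (sSup ((fun t => psiLam l0 l1 p t / psiTwo t) '' Set.Icc (0 : ℝ) 1)) ^ 2 := by
  have hp : 0 < p := by linarith
  have hbdd : BddAbove {r : ℝ | ∃ a b c d : ℝ, ¬(a = 0 ∧ b = 0 ∧ c = 0 ∧ d = 0) ∧
      r = ((NpLam l0 l1 p (a + c) (b + d)) ^ 2 + (NpLam l0 l1 p (a - c) (b - d)) ^ 2) /
        (2 * ((NpLam l0 l1 p a b) ^ 2 + (NpLam l0 l1 p c d) ^ 2))} := by
    refine ⟨(sSup ((fun t => psiLam l0 l1 p t / psiTwo t) '' Set.Icc (0 : ℝ) 1)) ^ 2, ?_⟩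
    rintro _ ⟨a, b, c, d, -, rfl⟩
    exact vonNeumannJordan_quotient_le h0 h01 hp1 hp2 a b c d
  refine le_antisymm (csSup_le ?_ ?_) ?_
  · exact ⟨_, sq_psiLam_div_psiTwo_eq_quotient h0 h01 hp ⟨le_rfl, zero_le_one⟩⟩
  · rintro _ ⟨a, b, c, d, -, rfl⟩
    exact vonNeumannJordan_quotient_le h0 h01 hp1 hp2 a b c d
  · have hmem {t : ℝ} (ht : t ∈ Set.Icc (0 : ℝ) 1) := le_csSup hbdd
      (sq_psiLam_div_psiTwo_eq_quotient h0 h01 hp ht)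
    rw [← Real.le_sqrt' ?_]
    · refine csSup_le ((Set.nonempty_Icc.2 zero_le_one).image _) ?_
      rintro _ ⟨t, ht, rfl⟩
      exact Real.le_sqrt_of_sq_le (hmem ht)
    · refine lt_of_lt_of_le ?_ (le_csSup (bddAbove_psiLam_div_psiTwo hp)
        (Set.mem_image_of_mem _ ⟨le_rfl, zero_le_one⟩))
      refine div_pos ?_ (psiTwo_pos 0)
      rw [psiLam_eq_quadrantNormLam, sub_zero,
        quadrantNormLam_zero_right h0 (h0.trans h01) hp zero_le_one]
      exact one_pos
end
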